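/- arXiv:2203.05451 — 2 statements merged into one kernel-verified Lean document; each statement's English description precedes it below -/
import Mathlib

section
/- Every odd positive integer n with s(n^2) = 3 satisfies n ∈ {2^t + 1 : t ≥ 2} ∪ {7, 23}, and conversely every element of this set has s(n^2) = 3, where s is the binary digit sum. -/
/-- binary digit sum -/
def s (n : ℕ) : ℕ := (Nat.digits 2 n).sum


namespace Szalay
open PowerSeries

theorem exists_sqrt : ∃ S : PowerSeries ℤ, S ^ 2 = 1 + 4 * X ∧ constantCoeff S = 1 := by
  have h := congrArg (PowerSeries.map (Nat.castRingHom ℤ)) catalanSeries_sq_mul_X_add_one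
  simp only [map_add, map_mul, map_pow, map_one, PowerSeries.map_X] at h
  set c := PowerSeries.map (Nat.castRingHom ℤ) catalanSeries
  refine ⟨rescale (-1 : ℤ) (1 - 2 * X * c), ?_, ?_⟩
  · rw [← map_pow]
    have : (1 - 2 * X * c) ^ 2 = 1 - 4 * X := by
      linear_combination (4 * X) * h
    rw [this]
    have h4 : (rescale (-1 : ℤ)) (4 : PowerSeries ℤ) = 4 := map_ofNat _ 4
    simp [rescale_X, h4]
  · rw [← coeff_zero_eq_constantCoeff_apply, coeff_rescale]
    simp [coeff_zero_eq_constantCoeff_apply]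

/-- chosen square root of 1 + 4 X -/
noncomputable def S : PowerSeries ℤ := exists_sqrt.choose
theorem S_sq : S ^ 2 = 1 + 4 * X := exists_sqrt.choose_spec.1
theorem S_zero : constantCoeff S = 1 := exists_sqrt.choose_spec.2

/-- formal derivative -/
noncomputable abbrev dd : PowerSeries ℤ → PowerSeries ℤ := derivative ℤ

theorem dd_u : dd (1 + 4 * X) = 4 := by
  ext i
  have : (4 : PowerSeries ℤ) = C (4:ℤ) := rfl
  rw [this]
  simp only [dd, coeff_derivative, map_add, coeff_C_mul, coeff_X, coeff_one, coeff_C]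
  rcases i with _ | i <;> simp

theorem u_ne : (1 + 4 * X : PowerSeries ℤ) ≠ 0 := by
  intro h
  have := congrArg constantCoeff h
  simp at this

theorem nat_ne (k : ℕ) (h : k ≠ 0) : (k : PowerSeries ℤ) ≠ 0 := by
  intro h0
  have := congrArg constantCoeff h0
  simp at this
  exact h this

theorem S_dS : S * dd S = 2 := by
  have h : dd (S ^ 2) = 4 := by rw [S_sq, dd_u]
  have h2 : dd (S ^ 2) = 2 * (S * dd S) := by
    simp only [dd, pow_two, Derivation.leibniz, smul_eq_mul]; ring
  rw [h2] at h
  have h3 : (2 : PowerSeries ℤ) * (S * dd S) = 2 * 2 := by rw [h]; norm_num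
  exact mul_left_cancel₀ (by simpa using nat_ne 2 (by norm_num)) h3

/-- half-integer power of the base series -/
noncomputable def fs (N : ℕ) : PowerSeries ℤ := (1 + 4 * X) ^ N * S

theorem fs_ode (N : ℕ) : (1 + 4 * X) * dd (fs N) = (4 * N + 2 : ℤ) • fs N := by
  induction N with
  | zero =>
    simp only [fs, pow_zero, one_mul, ← S_sq]
    rw [pow_two, mul_assoc, S_dS]; simp; ring
  | succ N ih =>
    have h1 : fs (N+1) = (1 + 4 * X) * fs N := by simp only [fs]; ring
    have h2 : dd (fs (N+1)) = (1 + 4 * X) * dd (fs N) + fs N * 4 := by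
      rw [h1]
      have := dd_u
      simp only [dd] at this ⊢
      rw [Derivation.leibniz, this]; simp
    rw [h2, ih, h1]
    simp only [zsmul_eq_mul]; push_cast; ring

/-- coefficients -/
noncomputable def fc (N i : ℕ) : ℤ := coeff i (fs N)

theorem fc_zero (N : ℕ) : fc N 0 = 1 := by
  simp [fc, fs, S_zero, coeff_zero_eq_constantCoeff_apply]

theorem fc_rec (N j : ℕ) : ((j : ℤ) + 1) * fc N (j+1) = (4 * N + 2 - 4 * j) * fc N j := by
  have h := congrArg (coeff j) (fs_ode N)
  have h4 : (4 : PowerSeries ℤ) = C (4:ℤ) := rfl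
  rw [add_mul, one_mul, map_add, mul_assoc, h4, coeff_C_mul, map_smul] at h
  rcases j with _ | j
  · simp only [coeff_zero_X_mul, dd, coeff_derivative] at h
    simp only [fc]; simp at h ⊢; linarith
  · simp only [coeff_succ_X_mul, dd, coeff_derivative] at h
    simp only [fc]; simp only [smul_eq_mul] at h; push_cast at h ⊢; linarith

/-- Hasse derivative -/
noncomputable def hs (N j : ℕ) : PowerSeries ℤ := mk fun i => ((i+j).choose j : ℤ) * fc N (i+j)

theorem dd_hs (N j : ℕ) : dd (hs N j) = ((j : ℤ) + 1) • hs N (j+1) := by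
  ext i
  rw [map_zsmul, zsmul_eq_mul]
  simp only [dd, coeff_derivative, hs, coeff_mk]
  push_cast
  have e : i + 1 + j = i + (j + 1) := by ring
  rw [e]
  have := Nat.add_one_mul_choose_eq (i+j) j
  have h2 := Nat.choose_succ_right_eq (i+(j+1)) j
  have e3 : i + (j+1) - j = i + 1 := by omega
  rw [e3] at h2
  have h3 : (((i+(j+1)).choose (j+1) : ℤ)) * (j+1) = ((i+(j+1)).choose j : ℤ) * (i+1) := by exact_mod_cast h2
  linear_combination (-fc N (i+(j+1))) * h3

theorem S_hs (N j : ℕ) (e : ℕ) (he : j + e = N + 1) :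
    S * hs N j = (fc N j) • (1 + 4 * X) ^ e := by
  induction j generalizing e with
  | zero =>
    have : hs N 0 = fs N := by ext i; simp [hs, fc]
    have he' : e = N + 1 := by omega
    rw [this, fc_zero, fs, he', one_smul, pow_succ, mul_left_comm, ← pow_two, S_sq]
  | succ j ih =>
    have ih := ih (e+1) (by omega)
    have hh : hs N j = (fc N j) • ((1 + 4 * X) ^ e * S) := by
      apply mul_left_cancel₀ u_ne
      rw [← S_sq]
      calc S ^ 2 * hs N j = S * (S * hs N j) := by ring
        _ = _ := by rw [ih, S_sq]; simp only [zsmul_eq_mul]; ring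
    have hd : dd (S * hs N j) = (fc N j) • ((e+1 : ℤ) • ((1 + 4 * X) ^ e * 4)) := by
      rw [ih]
      have := dd_u
      simp only [dd] at this ⊢
      rw [map_zsmul, Derivation.leibniz_pow, this]; simp
    have hd2 : dd (S * hs N j) = S * dd (hs N j) + hs N j * dd S := by
      simp only [dd]; rw [Derivation.leibniz]; simp
    rw [hd2, dd_hs] at hd
    have hr := fc_rec N j
    have hN : (N : ℤ) = j + e := by omega
    rw [hN] at hr
    have hr' : ((j : PowerSeries ℤ) + 1) * ((fc N (j+1) : ℤ) : PowerSeries ℤ) = (4 * e + 2) * ((fc N j : ℤ) : PowerSeries ℤ) := by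
      have := congrArg (fun z : ℤ => (z : PowerSeries ℤ)) hr
      push_cast at this
      linear_combination this
    have hj : ((j : PowerSeries ℤ) + 1) ≠ 0 := by
      have : ((j+1 : ℕ) : PowerSeries ℤ) ≠ 0 := nat_ne _ (Nat.succ_ne_zero j)
      exact_mod_cast this
    apply mul_left_cancel₀ hj
    rw [hh] at hd
    simp only [zsmul_eq_mul] at hd ⊢
    push_cast at hd ⊢
    have hS := S_dS
    linear_combination hd - (((fc N j : ℤ) : PowerSeries ℤ) * (1 + 4 * X)^e) * hS - (1+4*X)^e * hr'

theorem choose_alt (i : ℕ) : ∀ n p : ℕ, i ≤ n → p ≤ n →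
    ∑ j ∈ Finset.range (p+1), (-1 : ℤ)^j * (i.choose j) * ((n-j).choose (p-j)) = ((n-i).choose p : ℤ) := by
  induction i with
  | zero =>
    intro n p _ _
    rw [Finset.sum_range_succ']
    simp
  | succ i ih =>
    intro n p hi hp
    rcases p with _ | p
    · simp
    obtain ⟨n, rfl⟩ : ∃ k, n = k + 1 := ⟨n-1, by omega⟩
    have h1 := ih (n+1) (p+1) (by omega) hp
    have h2 := ih n p (by omega) (by omega)
    rw [Finset.sum_range_succ'] at h1 ⊢
    simp only [Nat.choose_succ_succ i, Nat.add_sub_add_right] at h1 ⊢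
    have e : n + 1 - i = (n - i) + 1 := by omega
    rw [e, Nat.choose_succ_succ] at h1
    have key : ∀ x ∈ Finset.range (p+1), (-1:ℤ)^(x+1) * ((i.choose x + i.choose (x+1) : ℕ) : ℤ) * ((n-x).choose (p-x)) =
       (-1:ℤ)^(x+1) * (i.choose (x+1)) * ((n-x).choose (p-x)) - (-1:ℤ)^x * (i.choose x) * ((n-x).choose (p-x)) := by
      intro x _; push_cast; ring
    rw [Finset.sum_congr rfl key, Finset.sum_sub_distrib, h2]
    push_cast at h1
    simp at h1 ⊢
    linarith

/-- full series -/
noncomputable def Qf (N n : ℕ) : PowerSeries ℤ :=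
  ∑ j ∈ Finset.range (N+2), ((-1 : ℤ)^j * ((n-j).choose (N+1-j))) • (X^j * hs N j)

theorem coeff_Qf (N n i : ℕ) (hi : i ≤ n) (hN : N + 1 ≤ n) :
    coeff i (Qf N n) = ((n-i).choose (N+1) : ℤ) * fc N i := by
  rw [← choose_alt i n (N+1) hi hN, Qf, map_sum, Finset.sum_mul]
  apply Finset.sum_congr rfl
  intro j _
  rw [map_smul, coeff_X_pow_mul']
  split_ifs with h
  · simp only [hs, coeff_mk, smul_eq_mul, Nat.sub_add_cancel h]; ring
  · rw [Nat.choose_eq_zero_of_lt (show i < j by omega)]; simp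

/-- numerator polynomial -/
noncomputable def Pp (N n : ℕ) : Polynomial ℤ :=
  ∑ j ∈ Finset.range (N+2), ((-1 : ℤ)^j * ((n-j).choose (N+1-j)) * fc N j) •
    (Polynomial.X^j * (1 + 4 * Polynomial.X)^(N+1-j))

theorem S_Qf (N n : ℕ) : S * Qf N n = (Pp N n : PowerSeries ℤ) := by
  have : (Pp N n : PowerSeries ℤ) = Polynomial.coeToPowerSeries.ringHom (Pp N n) := rfl
  rw [this, Pp, map_sum, Qf, Finset.mul_sum]
  apply Finset.sum_congr rfl
  intro j hj
  have := S_hs N j (N+1-j) (by simp at hj; omega)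
  have h4 : Polynomial.coeToPowerSeries.ringHom (4 : Polynomial ℤ) = 4 := map_ofNat _ 4
  have hX : Polynomial.coeToPowerSeries.ringHom (Polynomial.X : Polynomial ℤ) = X := by simp
  rw [zsmul_eq_mul, zsmul_eq_mul, map_mul, map_mul, map_pow, map_pow, map_add, map_mul, h4, hX, map_one, map_intCast]
  rw [zsmul_eq_mul] at this
  push_cast
  linear_combination ((-1)^j * ((n-j).choose (N+1-j) : PowerSeries ℤ) * X^j) * this

theorem eval_trunc (n : ℕ) (y : ℤ) (F G : PowerSeries ℤ) (H : Polynomial ℤ) (h : F * G = H) :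
    y^n ∣ (trunc n F).eval y * (trunc n G).eval y - H.eval y := by
  have : Polynomial.X ^ n ∣ trunc n F * trunc n G - H := by
    rw [Polynomial.X_pow_dvd_iff]
    intro d hd
    rw [Polynomial.coeff_sub, ← Polynomial.coeff_coe, ← Polynomial.coeff_coe H, ← h, Polynomial.coe_mul,
      ← coeff_mul_eq_coeff_trunc_mul_trunc _ _ hd, sub_self]
  obtain ⟨R, hR⟩ := this
  have := congrArg (Polynomial.eval y) hR
  simp at this
  exact ⟨_, this⟩

/-- The main approximation statement. -/
theorem pade (N n : ℕ) (hN : N + 1 ≤ n) (y : ℤ) : ∃ σ : ℤ,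
    y^(n+1) ∣ σ^2 - (1+4*y) ∧
    y^(n+1) ∣ σ * (∑ i ∈ Finset.range (n+1), ((n-i).choose (N+1) : ℤ) * fc N i * y^i) -
      ∑ j ∈ Finset.range (N+2), (-1 : ℤ)^j * ((n-j).choose (N+1-j)) * fc N j * (y^j * (1+4*y)^(N+1-j)) := by
  refine ⟨(trunc (n+1) S).eval y, ?_, ?_⟩
  · have := eval_trunc (n+1) y S S (1 + 4 * Polynomial.X) (by
      rw [← pow_two, S_sq]
      have h4 : Polynomial.coeToPowerSeries.ringHom (4 : Polynomial ℤ) = 4 := map_ofNat _ 4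
      have h4' : ((4 : Polynomial ℤ) : PowerSeries ℤ) = 4 := h4
      simp [h4'])
    simpa [pow_two] using this
  · have := eval_trunc (n+1) y S (Qf N n) (Pp N n) (S_Qf N n)
    have h1 : (trunc (n+1) (Qf N n)).eval y = ∑ i ∈ Finset.range (n+1), ((n-i).choose (N+1) : ℤ) * fc N i * y^i := by
      rw [Polynomial.eval_eq_sum_range' (natDegree_trunc_lt _ n)]
      apply Finset.sum_congr rfl
      intro i hi
      rw [coeff_trunc, if_pos (by simpa using hi), coeff_Qf N n i (by simp at hi; omega) hN]
    have h2 : (Pp N n).eval y = ∑ j ∈ Finset.range (N+2), (-1 : ℤ)^j * ((n-j).choose (N+1-j)) * fc N j * (y^j * (1+4*y)^(N+1-j)) := by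
      rw [Pp, Polynomial.eval_finsetSum]
      apply Finset.sum_congr rfl
      intro i hi
      rw [Polynomial.eval_smul]
      simp
    rwa [h1, h2] at this

end Szalay

namespace Szalay

theorem fc_pos (N i : ℕ) (hi : i ≤ N + 1) : 0 < fc N i := by
  induction i with
  | zero => rw [fc_zero]; norm_num
  | succ i ih =>
    have h := fc_rec N i
    have h1 : (i : ℤ) ≤ N := by omega
    have h2 : 0 < (4 * (N:ℤ) + 2 - 4 * i) * fc N i := mul_pos (by linarith) (ih (by omega))
    rw [← h] at h2
    exact pos_of_mul_pos_right h2 (by positivity)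

theorem fc_le (N i : ℕ) (hi : i ≤ N + 1) : fc N i ≤ 4^i * ((N+1).choose i : ℤ) := by
  induction i with
  | zero => rw [fc_zero]; norm_num
  | succ i ih =>
    have h := fc_rec N i
    have h1 : (i : ℤ) ≤ N := by omega
    have h2 := Nat.choose_succ_right_eq (N+1) i
    have h3 : (((N+1).choose (i+1) : ℤ)) * (i+1) = ((N+1).choose i : ℤ) * (N + 1 - i) := by
      have : ((N + 1 - i : ℕ) : ℤ) = N + 1 - i := by omega
      rw [← this]; exact_mod_cast h2
    have ih := ih (by omega)
    have hp := fc_pos N i (by omega)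
    have : ((i:ℤ)+1) * fc N (i+1) ≤ (i+1) * (4^(i+1) * ((N+1).choose (i+1) : ℤ)) := by
      rw [h]
      calc (4 * (N:ℤ) + 2 - 4 * i) * fc N i ≤ (4 * (N + 1 - i)) * fc N i := by
            apply mul_le_mul_of_nonneg_right _ hp.le; linarith
        _ ≤ (4 * (N + 1 - i)) * (4^i * ((N+1).choose i : ℤ)) := by
            apply mul_le_mul_of_nonneg_left ih; linarith
        _ = _ := by rw [pow_succ]; linear_combination (-4 * 4^i) * h3
    exact le_of_mul_le_mul_left this (by positivity)

theorem fc_ge (N i : ℕ) (hi : i ≤ N + 1) : 4^i * (N.choose i : ℤ) ≤ fc N i := by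
  induction i with
  | zero => rw [fc_zero]; norm_num
  | succ i ih =>
    have h := fc_rec N i
    have h1 : (i : ℤ) ≤ N := by omega
    have h2 := Nat.choose_succ_right_eq N i
    have h3 : ((N.choose (i+1) : ℤ)) * (i+1) = (N.choose i : ℤ) * (N - i) := by
      have : ((N - i : ℕ) : ℤ) = N - i := by omega
      rw [← this]; exact_mod_cast h2
    have ih := ih (by omega)
    have hp := fc_pos N i (by omega)
    have : ((i:ℤ)+1) * (4^(i+1) * (N.choose (i+1) : ℤ)) ≤ (i+1) * fc N (i+1) := by
      rw [h]
      calc ((i:ℤ)+1) * (4^(i+1) * (N.choose (i+1) : ℤ)) = (4 * (N - i)) * (4^i * (N.choose i : ℤ)) := by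
            rw [pow_succ]; linear_combination (4 * 4^i) * h3
        _ ≤ (4 * (N - i)) * fc N i := by
            apply mul_le_mul_of_nonneg_left ih; linarith
        _ ≤ _ := by
            apply mul_le_mul_of_nonneg_right _ hp.le; linarith
    exact le_of_mul_le_mul_left this (by positivity)

theorem choose_id (k i : ℕ) (hi : i ≤ k) :
    (3*k-i).choose (2*k) * (2*k).choose i = (3*k-i).choose k * k.choose i := by
  rw [Nat.choose_mul (by omega), Nat.choose_mul hi]
  congr 1
  rw [← Nat.choose_symm (show 2*k-i ≤ 3*k-i-i by omega)]
  congr 1; omega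

theorem choose_two (a b : ℕ) : ((a.choose b : ℕ) : ℤ) ≤ 2^a := by
  exact_mod_cast Nat.choose_le_two_pow a b

/-- denominators -/
noncomputable def QQ (k : ℕ) (y : ℤ) : ℤ :=
  ∑ i ∈ Finset.range (3*k+1), ((3*k-i).choose (2*k) : ℤ) * fc (2*k-1) i * y^i

/-- numerators -/
noncomputable def PP (k : ℕ) (y : ℤ) : ℤ :=
  ∑ j ∈ Finset.range (2*k+1), (-1 : ℤ)^j * ((3*k-j).choose (2*k-j)) * fc (2*k-1) j * (y^j * (1+4*y)^(2*k-j))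

theorem QQ_eq (k : ℕ) (y : ℤ) : QQ k y =
    ∑ i ∈ Finset.range (k+1), ((3*k-i).choose (2*k) : ℤ) * fc (2*k-1) i * y^i := by
  rw [QQ]
  symm
  apply Finset.sum_subset
  · intro i; simp; omega
  · intro i h1 h2
    simp at h1 h2
    rw [Nat.choose_eq_zero_of_lt (show 3*k-i < 2*k by omega)]; simp

theorem QQ_le (k : ℕ) (hk : 1 ≤ k) (y : ℤ) (hy : 0 ≤ y) : QQ k y ≤ 2^(2*k) * (4*y+2)^k := by
  rw [QQ_eq, add_pow, Finset.mul_sum]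
  apply Finset.sum_le_sum
  intro i hi
  have hi : i ≤ k := by simp at hi; omega
  have h1 := fc_le (2*k-1) i (by omega)
  have e : 2*k-1+1 = 2*k := by omega
  rw [e] at h1
  have h2 : ((3*k-i).choose (2*k) : ℤ) * ((2*k).choose i) = (3*k-i).choose k * k.choose i := by
    exact_mod_cast choose_id k i hi
  have h3 := choose_two (3*k-i) k
  have e2 : (2:ℤ)^(3*k-i) = 2^(2*k) * 2^(k-i) := by rw [← pow_add]; congr 1; omega
  calc ((3*k-i).choose (2*k) : ℤ) * fc (2*k-1) i * y^i
      ≤ ((3*k-i).choose (2*k) : ℤ) * (4^i * ((2*k).choose i : ℤ)) * y^i := by gcongr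
    _ = ((3*k-i).choose k : ℤ) * ((k.choose i : ℤ) * (4 * y)^i) := by
        rw [mul_pow]; linear_combination (4^i * y^i) * h2
    _ ≤ 2^(3*k-i) * ((k.choose i : ℤ) * (4 * y)^i) := by gcongr
    _ = _ := by rw [e2]; ring

theorem QQ_ge (k : ℕ) (hk : 1 ≤ k) (y : ℤ) (hy : 0 ≤ y) : ((2*k-1).choose k : ℤ) * (4*y)^k ≤ QQ k y := by
  rw [QQ_eq]
  have h := Finset.single_le_sum (s := Finset.range (k+1))
    (f := fun i => ((3*k-i).choose (2*k) : ℤ) * fc (2*k-1) i * y^i) (a := k) (by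
      intro i hi
      have hi : i ≤ k := by simp at hi; omega
      have := fc_pos (2*k-1) i (by omega)
      positivity) (by simp)
  refine le_trans ?_ h
  have e : 3*k-k = 2*k := by omega
  simp only [e, Nat.choose_self]
  have h1 := fc_ge (2*k-1) k (by omega)
  rw [mul_pow]
  calc ((2*k-1).choose k : ℤ) * (4^k*y^k) = (4^k * ((2*k-1).choose k : ℤ)) * y^k := by ring
    _ ≤ fc (2*k-1) k * y^k := by gcongr
    _ = _ := by push_cast; ring

theorem PP_le (k : ℕ) (hk : 1 ≤ k) (y : ℤ) (hy : 0 ≤ y) : |PP k y| ≤ 2^k * (4*y + 2*(1+4*y))^(2*k) := by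
  rw [PP, add_pow, Finset.mul_sum]
  refine le_trans (Finset.abs_sum_le_sum_abs _ _) ?_
  apply Finset.sum_le_sum
  intro j hj
  have hj : j ≤ 2*k := by simp at hj; omega
  have h1 := fc_le (2*k-1) j (by omega)
  have h0 := fc_pos (2*k-1) j (by omega)
  have e : 2*k-1+1 = 2*k := by omega
  rw [e] at h1
  have h3 := choose_two (3*k-j) (2*k-j)
  have e2 : (2:ℤ)^(3*k-j) = 2^k * 2^(2*k-j) := by rw [← pow_add]; congr 1; omega
  have hA : 0 ≤ y^j * (1+4*y)^(2*k-j) := by positivity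
  rw [abs_mul, abs_mul, abs_mul, abs_pow, abs_neg, abs_one, one_pow, one_mul, abs_of_pos h0, abs_of_nonneg hA, Nat.abs_cast]
  calc ((3*k-j).choose (2*k-j) : ℤ) * fc (2*k-1) j * (y^j * (1+4*y)^(2*k-j))
     ≤ 2^(3*k-j) * (4^j * ((2*k).choose j : ℤ)) * (y^j * (1+4*y)^(2*k-j)) := by gcongr
   _ = _ := by rw [e2, mul_pow, mul_pow]; ring

theorem choose_big (l : ℕ) : 3^l ≤ (2*l+1).choose (l+1) := by
  have key : ∀ l, (2*l+1).choose (l+1) * 2 = Nat.centralBinom (l+1) := by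
    intro l
    rw [Nat.centralBinom, show 2*(l+1) = (2*l+1)+1 by ring, Nat.choose_succ_succ (2*l+1) l, Nat.succ_eq_add_one, Nat.choose_symm_half]; ring
  induction l with
  | zero => simp
  | succ l ih =>
    have h := Nat.succ_mul_centralBinom_succ (l+1)
    rw [← key, ← key] at h
    have h2 : (l+2) * (2*(l+1)+1).choose (l+1+1) = 2*(2*(l+1)+1) * (2*l+1).choose (l+1) := by
      have : (l+1+1) * ((2*(l+1)+1).choose (l+1+1) * 2) = 2 * ((l+2) * (2*(l+1)+1).choose (l+1+1)) := by ring
      rw [this] at h; linarith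
    have h3 : (l+2) * 3^(l+1) ≤ (l+2) * (2*(l+1)+1).choose (l+1+1) := by
      rw [h2, pow_succ]; nlinarith
    exact Nat.le_of_mul_le_mul_left h3 (by omega)

theorem odd_sq_dvd (M : ℕ) (s z : ℤ) (hs : Odd s) (hz : Odd z) (h : (2:ℤ)^(M+1) ∣ s^2 - z^2) :
    (2:ℤ)^M ∣ s - z ∨ (2:ℤ)^M ∣ s + z := by
  rcases M with _ | M
  · simp
  obtain ⟨A, hA⟩ := hs
  obtain ⟨B, hB⟩ := hz
  have e1 : s - z = 2 * (A - B) := by rw [hA, hB]; ring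
  have e2 : s + z = 2 * (A + B + 1) := by rw [hA, hB]; ring
  have e3 : s^2 - z^2 = 2^2 * ((A - B) * (A+B+1)) := by rw [hA, hB]; ring
  rw [e3, show M+1+1 = 2 + M by ring, pow_add] at h
  have h := (mul_dvd_mul_iff_left (by norm_num)).1 h
  rw [e1, e2, pow_succ']
  rcases Int.even_or_odd (A - B) with h1 | h1
  · left
    have : Odd (A+B+1) := by
      obtain ⟨r, hr⟩ := h1; exact ⟨r + B, by linarith⟩
    have hc : IsCoprime ((2:ℤ)^M) (A+B+1) := by
      apply IsCoprime.pow_left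
      obtain ⟨r, hr⟩ := this; exact ⟨-r, 1, by rw [hr]; ring⟩
    exact mul_dvd_mul_left _ (hc.dvd_of_dvd_mul_right h)
  · right
    have hc : IsCoprime ((2:ℤ)^M) (A-B) := by
      apply IsCoprime.pow_left
      obtain ⟨r, hr⟩ := h1; exact ⟨-r, 1, by rw [hr]; ring⟩
    exact mul_dvd_mul_left _ (hc.dvd_of_dvd_mul_left h)

set_option maxHeartbeats 1600000 in
theorem main_pade (m k b : ℕ) (z : ℤ) (hm : 10 ≤ m) (hk : 1 ≤ k) (hz : 0 < z) (hodd : Odd z)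
    (he : z^2 = 1 + 2^(m+2) + 2^b) (h1 : (2*m+10)*k+5 ≤ b) (h2 : b + 9*k+5 ≤ 4*m*k+2*m) : False := by
  set y : ℤ := 2^m with hy
  set w : ℤ := 2^(m+2) with hw
  have hwy : 4 * y = w := by rw [hy, hw, pow_add]; ring
  have hy0 : 0 ≤ y := by positivity
  have hw0 : 4096 ≤ w := by
    calc (4096:ℤ) = 2^12 := by norm_num
      _ ≤ w := by rw [hw]; gcongr <;> omega
  have hQl := QQ_ge k hk y hy0
  have hQu := QQ_le k hk y hy0
  have hP := PP_le k hk y hy0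
  set Q := QQ k y with hQdef
  set P := PP k y with hPdef
  obtain ⟨σ, s1, s2⟩ := pade (2*k-1) (3*k) (by omega) y
  rw [show 2*k-1+1 = 2*k by omega, show 2*k-1+2 = 2*k+1 by omega] at s2
  change y^(3*k+1) ∣ σ * Q - P at s2
  clear_value Q P y w
  rw [hwy] at hQl hQu hP
  have hch : (3:ℤ)^(k-1) ≤ ((2*k-1).choose k : ℤ) := by
    obtain ⟨l, rfl⟩ : ∃ l, k = l + 1 := ⟨k-1, by omega⟩
    have := choose_big l
    rw [show 2*(l+1)-1 = 2*l+1 by omega]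
    exact_mod_cast this
  have hQ1 : (3:ℤ)^(k-1) * w^k ≤ Q := le_trans (by gcongr) hQl
  have hQ0 : 0 < Q := lt_of_lt_of_le (by positivity) hQ1
  have hmk : 10 * k ≤ m * k := Nat.mul_le_mul_right k hm
  have hb3 : m + 3 ≤ b := by nlinarith
  have hz2 : z^2 ≤ 2^(b+1) := by
    have : (2:ℤ)^(m+3) ≤ 2^b := by gcongr; norm_num
    have e : (2:ℤ)^(m+3) = 2 * w := by rw [hw]; ring
    rw [he, pow_succ]; linarith
  -- upper bound on Q^2
  have hQ2 : Q^2 ≤ 2^((2*m+9)*k) := by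
    have a1 : Q^2 ≤ (2^(2*k) * (w+2)^k)^2 := by gcongr
    have a2 : (w+2)^2 ≤ 2*w^2 := by nlinarith
    have a3 : ((2:ℤ)^(2*k) * (w+2)^k)^2 = 2^(4*k) * ((w+2)^2)^k := by
      rw [mul_pow, ← pow_mul, ← pow_mul, ← pow_mul]; congr 2 <;> ring
    have a4 : ((w+2)^2)^k ≤ (2*w^2)^k := by gcongr
    calc Q^2 ≤ 2^(4*k) * (2*w^2)^k := by rw [a3] at a1; exact le_trans a1 (by gcongr)
      _ = 2^((2*m+9)*k) := by
        rw [mul_pow, hw, ← pow_mul, ← pow_mul, ← pow_add, ← pow_add]; congr 1; ring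
  have hzQ2 : (2*z*Q)^2 ≤ 2^(b+3+(2*m+9)*k) := by
    calc (2*z*Q)^2 = 4 * z^2 * Q^2 := by ring
      _ ≤ 4 * 2^(b+1) * 2^((2*m+9)*k) := by gcongr
      _ = _ := by rw [pow_add, pow_add, pow_add]; ring
  obtain ⟨M, hM⟩ : ∃ M, M + 1 = min b (m*(3*k+1)) := by
    refine ⟨min b (m*(3*k+1)) - 1, ?_⟩
    have : 1 ≤ min b (m*(3*k+1)) := by
      apply le_min <;> nlinarith
    omega
  have hzQ : 2*z*Q ≤ 2^M := by
    have : (2*z*Q)^2 ≤ (2^M)^2 := by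
      refine le_trans hzQ2 ?_
      rw [← pow_mul]
      apply pow_le_pow_right₀ (by norm_num)
      rcases min_choice b (m*(3*k+1)) with h | h
      · rw [h] at hM; nlinarith
      · rw [h] at hM; nlinarith
    exact le_of_sq_le_sq this (by positivity)
  -- comparison of P with zQ
  have hPz : |P| < z * Q := by
    have c1 : (w + 2*(1+w))*1000 ≤ 3001 * w := by linarith
    have c2 : (w+2*(1+w))^4 ≤ 82 * w^4 := by
      have : ((w + 2*(1+w))*1000)^4 ≤ (3001*w)^4 := by gcongr
      have hw4 : 0 ≤ w^4 := by positivity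
      rw [mul_pow, mul_pow] at this
      norm_num at this
      linarith
    have c3 : |P|^2 ≤ 328^k * w^(4*k) := by
      calc |P|^2 ≤ (2^k * (w+2*(1+w))^(2*k))^2 := by gcongr
        _ = 4^k * ((w+2*(1+w))^4)^k := by
          rw [mul_pow, ← pow_mul, ← pow_mul, ← pow_mul, show (4:ℤ) = 2^2 by norm_num, ← pow_mul]
          congr 2 <;> ring
        _ ≤ 4^k * (82*w^4)^k := by gcongr
        _ = _ := by rw [mul_pow, ← mul_assoc, ← mul_pow, ← pow_mul]; norm_num
    have c4 : 2^b * Q^2 < (z*Q)^2 := by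
      have hq : 0 < Q^2 := by positivity
      have hq2 : 2^b < z^2 := by rw [he]; linarith
      rw [mul_pow]
      exact mul_lt_mul_of_pos_right hq2 hq
    have c5 : 328^k * w^(4*k) ≤ 2^b * Q^2 := by
      have d1 : (2:ℤ)^((2*m+10)*k+5) ≤ 2^b := by gcongr; norm_num
      have d2 : (2:ℤ)^((2*m+10)*k+5) = 32 * 64^k * w^(2*k) := by
        rw [hw, show (64:ℤ) = 2^6 by norm_num, show (32:ℤ) = 2^5 by norm_num, ← pow_mul, ← pow_mul, ← pow_add, ← pow_add]
        congr 1; ring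
      have d3 : (3^(k-1) * w^k)^2 ≤ Q^2 := by gcongr
      have d4 : 9 * ((3:ℤ)^(k-1) * w^k)^2 = 9^k * w^(2*k) := by
        obtain ⟨l, rfl⟩ : ∃ l, k = l + 1 := ⟨k-1, by omega⟩
        simp only [Nat.add_sub_cancel]
        rw [mul_pow, ← pow_mul, show (9:ℤ) = 3^2 by norm_num, ← pow_mul, ← pow_mul]; ring
      have d5 : (328:ℤ)^k ≤ 576^k := by gcongr; norm_num
      have d6 : (576:ℤ)^k = 64^k * 9^k := by rw [← mul_pow]; norm_num
      have hww : w^(4*k) = w^(2*k) * w^(2*k) := by rw [← pow_add]; congr 1; ring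
      have hpw : (0:ℤ) ≤ 64^k * w^(2*k) := by positivity
      calc 328^k * w^(4*k) ≤ 576^k * w^(4*k) := by gcongr
        _ = (64^k * w^(2*k)) * (9^k * w^(2*k)) := by rw [d6, hww]; ring
        _ = (64^k * w^(2*k)) * (9 * (3^(k-1) * w^k)^2) := by rw [d4]
        _ ≤ (64^k * w^(2*k)) * (32 * (3^(k-1) * w^k)^2) := by gcongr; norm_num
        _ = (32 * 64^k * w^(2*k)) * (3^(k-1) * w^k)^2 := by ring
        _ ≤ 2^b * Q^2 := by rw [← d2]; gcongr
    have : |P|^2 < (z*Q)^2 := lt_of_le_of_lt (le_trans c3 c5) c4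
    exact lt_of_pow_lt_pow_left₀ 2 (by positivity) this
  have hyM : (2:ℤ)^(M+1) ∣ y^(3*k+1) := by
    rw [hy, ← pow_mul]; apply pow_dvd_pow; rw [hM]; exact min_le_right _ _
  have hbM : (2:ℤ)^(M+1) ∣ 2^b := by
    apply pow_dvd_pow; rw [hM]; exact min_le_left _ _
  have hσz : (2:ℤ)^(M+1) ∣ σ^2 - z^2 := by
    have : σ^2 - z^2 = (σ^2 - (1+4*y)) - 2^b := by rw [he, hwy]; ring
    rw [this]; exact dvd_sub (hyM.trans s1) hbM
  have hσ : Odd σ := by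
    have h2 : (2:ℤ) ∣ σ^2 - z^2 := (dvd_pow_self 2 (Nat.succ_ne_zero M)).trans hσz
    have hz2 : Odd (z^2) := hodd.pow
    have : Odd (σ^2) := by
      obtain ⟨r, hr⟩ := h2; obtain ⟨t, ht⟩ := hz2
      exact ⟨r + t, by linarith⟩
    exact (Int.odd_pow' (by norm_num)).1 this
  have hPa := abs_lt.1 hPz
  have s3 : (2:ℤ)^M ∣ σ * Q - P := (pow_dvd_pow 2 (Nat.le_succ M)).trans (hyM.trans s2)
  rcases odd_sq_dvd M σ z hσ hodd hσz with h | h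
  · have : (2:ℤ)^M ∣ z * Q - P := by
      have e : z * Q - P = (σ * Q - P) - (σ - z) * Q := by ring
      rw [e]; exact dvd_sub s3 (h.mul_right _)
    have := Int.le_of_dvd (by linarith) this
    linarith
  · have : (2:ℤ)^M ∣ z * Q + P := by
      have e : z * Q + P = (σ + z) * Q - (σ * Q - P) := by ring
      rw [e]; exact dvd_sub (h.mul_right _) s3
    have := Int.le_of_dvd (by linarith) this
    linarith

end Szalay

namespace Szalay

theorem caseE (z : ℤ) (a b : ℕ) (ha : 3 ≤ a) (hab : a < b) (hb : b + 2 ≤ 2 * a) (hz : 0 < z) (hodd : Odd z)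
    (he : z^2 = 1 + 2^a + 2^b) : z = 2^(a-1) + 1 ∨ z = 7 := by
  obtain ⟨α, rfl⟩ : ∃ α, a = α + 1 := ⟨a-1, by omega⟩
  simp only [Nat.add_sub_cancel]
  set T : ℤ := 2^α with hT
  have hT4 : 4 ≤ T := by
    calc (4:ℤ) = 2^2 := by norm_num
      _ ≤ T := by rw [hT]; gcongr <;> omega
  have e1 : (2:ℤ)^(α+1) = 2 * T := by rw [hT]; ring
  have hbT : (2:ℤ)^b ≤ T^2 := by
    rw [hT, ← pow_mul]; apply pow_le_pow_right₀ (by norm_num); omega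
  have hzT : z ≤ T + 1 := by
    have : z^2 ≤ (T+1)^2 := by rw [he, e1]; linarith
    exact le_of_sq_le_sq this (by linarith)
  have hb0 : (0:ℤ) < 2^b := by positivity
  have hd : (2:ℤ)^(α+1) ∣ z^2 - 1^2 := by
    rw [he]
    have : (1 + 2^(α+1) + 2^b - 1^2 : ℤ) = 2^(α+1) + 2^b := by ring
    rw [this]; exact dvd_add dvd_rfl (pow_dvd_pow 2 (by omega))
  rcases odd_sq_dvd α z 1 hodd odd_one hd with h | h
  · obtain ⟨q, hq⟩ := h
    rw [← hT] at hq
    left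
    have hz1 : 1 < z := by
      by_contra hh
      have : z = 1 := by linarith
      rw [this] at he; nlinarith
    have q0 : 0 < q := by
      by_contra hh
      have : q ≤ 0 := by linarith
      nlinarith
    have q1 : q < 2 := by
      by_contra hh
      have : 2 ≤ q := by linarith
      nlinarith
    have : q = 1 := by omega
    rw [this] at hq; linarith
  · obtain ⟨q, hq⟩ := h
    rw [← hT] at hq
    right
    have q0 : 0 < q := by
      by_contra hh
      have : q ≤ 0 := by linarith
      nlinarith
    have q1 : q < 2 := by
      by_contra hh
      have : 2 ≤ q := by linarith
      nlinarith
    have hq1 : q = 1 := by omega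
    have hzT1 : z = T - 1 := by rw [hq1] at hq; linarith
    obtain ⟨e, rfl⟩ : ∃ e, b = α + e := ⟨b - α, by omega⟩
    have h3 : T * 2^e = T * (T - 4) := by
      rw [hzT1, e1, pow_add, ← hT] at he; linarith
    have h4 : (2:ℤ)^e = T - 4 := mul_left_cancel₀ (by linarith) h3
    have he0 : (0:ℤ) < 2^e := by positivity
    have hα : 3 ≤ α := by
      by_contra hh
      have : T ≤ 2^2 := by rw [hT]; apply pow_le_pow_right₀ (by norm_num); omega
      linarith
    have h8 : (8:ℤ) ∣ T := by
      rw [hT, show (8:ℤ) = 2^3 by norm_num]; exact pow_dvd_pow 2 hα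
    have he2 : e ≤ 2 := by
      by_contra hh
      have h8' : (8:ℤ) ∣ 2^e := by
        rw [show (8:ℤ) = 2^3 by norm_num]; exact pow_dvd_pow 2 (by omega)
      omega
    have : (2:ℤ)^e ≤ 2^2 := pow_le_pow_right₀ (by norm_num) he2
    omega

theorem caseF (z : ℤ) (m b : ℕ) (hm : 2 ≤ m) (hb : 2*m+3 ≤ b) (hz : 0 < z) (hodd : Odd z)
    (he : z^2 = 1 + 2^(m+2) + 2^b) : z = 2^(m+1) + 1 ∨ 4 * m ≤ b := by
  set c : ℤ := 2^(m+1) + 1 with hc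
  have hcodd : Odd c := ⟨2^m, by rw [hc]; ring⟩
  have hd : (2:ℤ)^(2*m+1+1) ∣ z^2 - c^2 := by
    have : z^2 - c^2 = 2^b - 2^(2*m+1+1) := by rw [he, hc]; ring
    rw [this]; exact dvd_sub (pow_dvd_pow 2 (by omega)) dvd_rfl
  have hV : (2:ℤ)^(2*m+1) = 2 * 2^(2*m) := by ring
  have hcV : c ≤ 2^(2*m) := by
    have h1 : (2:ℤ)^(2*m) = 2^m * 2^m := by ring
    have h2 : (4:ℤ) ≤ 2^m := by
      calc (4:ℤ) = 2^2 := by norm_num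
        _ ≤ _ := pow_le_pow_right₀ (by norm_num) hm
    rw [hc, h1, pow_succ]; nlinarith
  have hc0 : 0 < c := by positivity
  set W : ℤ := 2^(2*m) with hW
  have hW0 : 0 < W := by positivity
  by_cases hzc : z = c
  · left; exact hzc
  right
  have hzW : W ≤ z := by
    rcases odd_sq_dvd _ z c hodd hcodd hd with h | h
    · obtain ⟨q, hq⟩ := h
      rw [hV] at hq
      have q0 : q ≠ 0 := by rintro rfl; apply hzc; linarith
      have q1 : 0 < q := by
        by_contra hh
        have : q ≤ -1 := by omega
        nlinarith
      nlinarith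
    · obtain ⟨q, hq⟩ := h
      rw [hV] at hq
      have q1 : 0 < q := by
        by_contra hh
        have : q ≤ 0 := by omega
        nlinarith
      nlinarith
  have h1 : (2:ℤ)^(4*m) ≤ z^2 := by
    have : (2:ℤ)^(4*m) = W^2 := by rw [hW, ← pow_mul]; congr 1; ring
    rw [this]; gcongr
  have h2 : z^2 < 2^(b+1) := by
    have : (2:ℤ)^(m+3) ≤ 2^b := pow_le_pow_right₀ (by norm_num) (by omega)
    have e : (2:ℤ)^(m+3) = 2 * 2^(m+2) := by ring
    have h4 : (4:ℤ) ≤ 2^(m+2) := by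
      calc (4:ℤ) = 2^2 := by norm_num
        _ ≤ _ := pow_le_pow_right₀ (by norm_num) (by omega)
    have e5 : (2:ℤ)^(b+1) = 2 * 2^b := by ring
    rw [he, e5]; linarith
  have := (pow_lt_pow_iff_right₀ (by norm_num : (1:ℤ) < 2)).1 (lt_of_le_of_lt h1 h2)
  omega

/-- unit action modulo M -/
def st (M : ℕ) (p : ℕ × ℕ) : ℕ × ℕ := ((3 * p.1 + 4 * p.2) % M, (2 * p.1 + 3 * p.2) % M)

/-- orbit list -/
def orb (M : ℕ) : ℕ → ℕ × ℕ → List (ℕ × ℕ)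
  | 0, _ => []
  | k+1, p => p :: orb M k (st M p)

theorem pell (D M B : ℕ) (L : List (ℕ × ℕ)) (hL : ∀ p ∈ L, st M p ∈ L) (hBD : 4 * D < (B+1)^2)
    (hB : ∀ y x : ℕ, 0 < y → y ≤ B → x^2 = 2*y^2 + D → (x % M, y % M) ∈ L) :
    ∀ y x : ℕ, 0 < y → x^2 = 2*y^2 + D → (x % M, y % M) ∈ L := by
  intro y
  induction y using Nat.strong_induction_on with
  | _ y ih =>
    intro x hy hx
    by_cases hyB : y ≤ B
    · exact hB y x hy hyB hx
    have hyD : 4 * D < y^2 := lt_of_lt_of_le hBD (Nat.pow_le_pow_left (by omega) 2)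
    have h1 : 2 * x < 3 * y := by
      by_contra hh
      have : 3 * y ≤ 2 * x := by omega
      nlinarith
    have h2 : 4 * y ≤ 3 * x := by
      by_contra hh
      have : 3 * x ≤ 4 * y := by omega
      nlinarith
    have h3 : y ≤ x := by
      by_contra hh
      have : x ≤ y := by omega
      nlinarith
    obtain ⟨y', hy'⟩ : ∃ y', 3 * y = 2 * x + y' := ⟨3*y-2*x, by omega⟩
    obtain ⟨x', hx'⟩ : ∃ x', 3 * x = 4 * y + x' := ⟨3*x-4*y, by omega⟩
    have ex : x = 3 * x' + 4 * y' := by omega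
    have ey : y = 2 * x' + 3 * y' := by omega
    have hn : x'^2 = 2*y'^2 + D := by
      rw [ex, ey] at hx; nlinarith
    have hlt : y' < y := by
      by_contra hh
      have : x' = 0 := by omega
      have : y = x := by omega
      have : D = 0 := by nlinarith
      nlinarith
    have := hL _ (ih y' hlt x' (by omega) hn)
    rw [st] at this
    rw [ex, ey]
    convert this using 2
    · simp [Nat.add_mod, Nat.mul_mod]
    · simp [Nat.add_mod, Nat.mul_mod]

theorem pell17 (x c : ℕ) (hc : 5 ≤ c) (h : x^2 = 2*(2^c)^2 + 17) : False := by
  have h1 := pell 17 8224 8 (orb 8224 64 (5,2) ++ orb 8224 64 (7,4)) (by decide +kernel) (by norm_num) (by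
    intro y x hy hy8 hx
    have hx' : x < 20 := by nlinarith
    have : ∀ y : Fin 9, ∀ x : Fin 20, (0 < y.1 ∧ x.1^2 = 2*y.1^2+17) → (x.1 % 8224, y.1 % 8224) ∈ (orb 8224 64 (5,2) ++ orb 8224 64 (7,4)) := by
      decide +kernel
    exact this ⟨y, by omega⟩ ⟨x, hx'⟩ ⟨hy, hx⟩) (2^c) x (by positivity) h
  have key : ∀ p ∈ (orb 8224 64 (5,2) ++ orb 8224 64 (7,4)), p.2 % 32 = 0 → ∀ j < 16, p.2 % 257 ≠ 2^j % 257 := by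
    decide +kernel
  refine key _ h1 ?_ (c % 16) (Nat.mod_lt _ (by norm_num)) ?_
  · obtain ⟨d, rfl⟩ : ∃ d, c = d + 5 := ⟨c-5, by omega⟩
    have : 2^(d+5) = 2^d * 32 := by ring
    simp only [this]; omega
  · simp only
    rw [Nat.mod_mod_of_dvd _ (by norm_num)]
    conv_lhs => rw [← Nat.div_add_mod c 16, pow_add, pow_mul, Nat.mul_mod, Nat.pow_mod]
    norm_num

theorem pell257 (x c : ℕ) (hc : 3 ≤ c) (h : x^2 = 2*(2^c)^2 + 257) : False := by
  have h1 := pell 257 136 32 (orb 136 16 (17,4) ++ orb 136 16 (35,22)) (by decide +kernel) (by norm_num) (by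
    intro y x hy hy8 hx
    have hx' : x < 60 := by nlinarith
    have : ∀ y : Fin 33, ∀ x : Fin 60, (0 < y.1 ∧ x.1^2 = 2*y.1^2+257) → (x.1 % 136, y.1 % 136) ∈ (orb 136 16 (17,4) ++ orb 136 16 (35,22)) := by
      decide +kernel
    exact this ⟨y, by omega⟩ ⟨x, hx'⟩ ⟨hy, hx⟩) (2^c) x (by positivity) h
  have key : ∀ p ∈ (orb 136 16 (17,4) ++ orb 136 16 (35,22)), p.2 % 8 = 0 → ∀ j < 8, p.2 % 17 ≠ 2^j % 17 := by
    decide +kernel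
  refine key _ h1 ?_ (c % 8) (Nat.mod_lt _ (by norm_num)) ?_
  · obtain ⟨d, rfl⟩ : ∃ d, c = d + 3 := ⟨c-3, by omega⟩
    have : 2^(d+3) = 2^d * 8 := by ring
    simp only [this]; omega
  · simp only
    rw [Nat.mod_mod_of_dvd _ (by norm_num)]
    conv_lhs => rw [← Nat.div_add_mod c 8, pow_add, pow_mul, Nat.mul_mod, Nat.pow_mod]
    norm_num

/-- N is a non-residue modulo q -/
def nonres (N q : ℕ) : Prop := ∀ x < q, x * x % q ≠ N % q

instance (N q : ℕ) : Decidable (nonres N q) := by unfold nonres; infer_instance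

theorem nonres_ne (N q n : ℕ) (hq : 0 < q) (h : nonres N q) : n^2 ≠ N := by
  intro e
  apply h (n % q) (Nat.mod_lt _ hq)
  rw [← Nat.mul_mod, ← pow_two, e]

theorem s_even (n : ℕ) : s (2*n) = s n := by
  rcases Nat.eq_zero_or_pos n with rfl | h
  · simp
  · unfold s; rw [Nat.digits_def' (by norm_num) (by omega)]; simp

theorem s_odd (n : ℕ) : s (2*n+1) = s n + 1 := by
  unfold s; rw [Nat.digits_def' (by norm_num) (by omega)]
  have : (2*n+1)/2 = n := by omega
  rw [this]; simp [Nat.add_mod]; ring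

theorem s_pow_mul (t n : ℕ) : s (2^t * n) = s n := by
  induction t with
  | zero => simp
  | succ t ih => rw [show 2^(t+1)*n = 2*(2^t*n) by ring, s_even, ih]

theorem s_zero (n : ℕ) : s n = 0 → n = 0 := by
  induction n using Nat.strong_induction_on with
  | _ n ih =>
    intro h
    rcases Nat.even_or_odd' n with ⟨k, rfl | rfl⟩
    · rw [s_even] at h
      by_contra hk
      exact hk (by rw [ih k (by omega) h])
    · rw [s_odd] at h; omega

theorem s_one (n : ℕ) : s n = 1 → ∃ a, n = 2^a := by
  induction n using Nat.strong_induction_on with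
  | _ n ih =>
    intro h
    rcases Nat.even_or_odd' n with ⟨k, rfl | rfl⟩
    · rw [s_even] at h
      rcases Nat.eq_zero_or_pos k with rfl | hk
      · simp [s] at h
      obtain ⟨a, ha⟩ := ih k (by omega) h
      exact ⟨a+1, by rw [ha]; ring⟩
    · rw [s_odd] at h
      exact ⟨0, by rw [s_zero k (by omega)]; norm_num⟩

theorem s_two (n : ℕ) : s n = 2 → ∃ a b, a < b ∧ n = 2^a + 2^b := by
  induction n using Nat.strong_induction_on with
  | _ n ih =>
    intro h
    rcases Nat.even_or_odd' n with ⟨k, rfl | rfl⟩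
    · rw [s_even] at h
      rcases Nat.eq_zero_or_pos k with rfl | hk
      · simp [s] at h
      obtain ⟨a, b, hab, ha⟩ := ih k (by omega) h
      exact ⟨a+1, b+1, by omega, by rw [ha]; ring⟩
    · rw [s_odd] at h
      obtain ⟨a, ha⟩ := s_one k (by omega)
      exact ⟨0, a+1, by omega, by rw [ha]; ring⟩

theorem finite_check : ∀ a ∈ [12, 16, 20], ∀ c < 288,
    ∃ q ∈ [7, 19, 307, 97, 11, 233, 59, 41, 241, 71, 113, 397, 37], nonres (1 + 2^a + 2^(2*c+1)) q ∨ 2*c+1 ≤ a := by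
  decide +kernel

theorem odd_large (n a c : ℕ) (hn : Odd n) (ha : 12 ≤ a) (ha4 : a % 4 = 0) (hab : a < 2*c+1)
    (he : n^2 = 1 + 2^a + 2^(2*c+1)) : n = 2^(a-1) + 1 ∨ n = 7 := by
  set b := 2*c+1 with hb
  have hz : (n:ℤ)^2 = 1 + 2^a + 2^b := by exact_mod_cast he
  have hodd : Odd (n:ℤ) := by exact_mod_cast hn
  have hpos : (0:ℤ) < n := by exact_mod_cast hn.pos
  by_cases hE : b + 2 ≤ 2*a
  · rcases caseE n a b (by omega) hab hE hpos hodd hz with h | h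
    · left; exact_mod_cast h
    · right; exact_mod_cast h
  obtain ⟨m, rfl⟩ : ∃ m, a = m + 2 := ⟨a-2, by omega⟩
  rcases caseF n m b (by omega) (by omega) hpos hodd hz with h | h
  · left; simp only [show m + 2 - 1 = m + 1 by omega]; exact_mod_cast h
  exfalso
  set k := (b-5)/(2*m+10) with hk
  have k1 : (2*m+10)*k ≤ b - 5 := Nat.mul_div_le _ _
  have k2 : b - 5 < (2*m+10)*(k+1) := Nat.lt_mul_div_succ _ (by omega)
  have fin : ∀ k0, 1 ≤ k0 → k0 ≤ k → 19*k0 + 19 ≤ 2*m*k0 → False := by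
    intro k0 h1 h2 h3
    apply main_pade m k b n (by omega) (by omega) hpos hodd hz (by omega)
    have : 19 * k + 19 ≤ 2*m*k := by
      obtain ⟨d, hd⟩ : ∃ d, k = k0 + d := ⟨k - k0, by omega⟩
      rw [hd]; nlinarith
    have e1 : (2*m+10)*(k+1) = 2*m*k + 10*k + 2*m + 10 := by ring
    have e2 : 4*m*k = 2*(2*m*k) := by ring
    omega
  have small : m + 2 ∈ [12, 16, 20] → c < 288 → False := by
    intro hm hc
    obtain ⟨q, hq, h1 | h1⟩ := finite_check (m+2) hm c hc
    · refine nonres_ne _ q n ?_ h1 he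
      have : ∀ q ∈ [7, 19, 307, 97, 11, 233, 59, 41, 241, 71, 113, 397, 37], 0 < q := by decide
      exact this q hq
    · omega
  by_cases h19 : 19 ≤ m
  · apply fin 1 le_rfl _ (by omega)
    rw [hk, Nat.le_div_iff_mul_le (by omega)]; omega
  · have hm3 : m = 10 ∨ m = 14 ∨ m = 18 := by omega
    by_cases hc : c < 288
    · apply small _ hc
      rcases hm3 with rfl | rfl | rfl <;> simp
    · rcases hm3 with rfl | rfl | rfl
      · apply fin 19 (by norm_num) _ (by omega)
        rw [hk, Nat.le_div_iff_mul_le (by omega)]; omega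
      · apply fin 3 (by norm_num) _ (by omega)
        rw [hk, Nat.le_div_iff_mul_le (by omega)]; omega
      · apply fin 2 (by norm_num) _ (by omega)
        rw [hk, Nat.le_div_iff_mul_le (by omega)]; omega

end Szalay

namespace Szalay

theorem core (n a b : ℕ) (hn : Odd n) (ha1 : 1 ≤ a) (hab : a < b) (he : n^2 = 1 + 2^a + 2^b) :
    (∃ t, 2 ≤ t ∧ n = 2^t + 1) ∨ n = 7 ∨ n = 23 := by
  have hz : (n:ℤ)^2 = 1 + 2^a + 2^b := by exact_mod_cast he
  have hodd : Odd (n:ℤ) := by exact_mod_cast hn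
  have hpos : (0:ℤ) < n := by exact_mod_cast hn.pos
  have h8 : n^2 % 8 = 1 := by
    have h1 : n % 8 = 1 ∨ n % 8 = 3 ∨ n % 8 = 5 ∨ n % 8 = 7 := by
      obtain ⟨k, rfl⟩ := hn; omega
    rcases h1 with h | h | h | h <;> simp [Nat.pow_mod, h]
  have ha3 : 3 ≤ a := by
    by_contra hh
    have : a = 1 ∨ a = 2 := by omega
    rcases this with rfl | rfl
    · obtain ⟨d, rfl⟩ : ∃ d, b = d + 2 := ⟨b-2, by omega⟩
      rw [pow_add] at he; omega
    · obtain ⟨d, rfl⟩ : ∃ d, b = d + 3 := ⟨b-3, by omega⟩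
      rw [pow_add] at he; omega
  have fin : (n = 2^(a-1) + 1 ∨ n = 7) → (∃ t, 2 ≤ t ∧ n = 2^t + 1) ∨ n = 7 ∨ n = 23 := by
    rintro (h | h)
    · left; exact ⟨a-1, by omega, h⟩
    · right; left; exact h
  rcases Nat.even_or_odd' b with ⟨c, rfl | rfl⟩
  · have e1 : 2^(2*c) = (2^c)^2 := by rw [← pow_mul]; congr 1; ring
    have h1 : 2^c < n := by
      by_contra hh
      have : n^2 ≤ (2^c)^2 := Nat.pow_le_pow_left (by omega) 2
      rw [he, e1] at this
      have : 0 < 2^a := by positivity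
      omega
    have h2 : (2^c+1)^2 ≤ n^2 := Nat.pow_le_pow_left h1 2
    have h3 : 2^(c+1) ≤ 2^a := by
      rw [he, e1] at h2
      have : 2^(c+1) = 2 * 2^c := by ring
      nlinarith
    have h4 := (Nat.pow_le_pow_iff_right (by norm_num)).1 h3
    apply fin
    rcases caseE n a (2*c) ha3 hab (by omega) hpos hodd hz with h | h
    · left; exact_mod_cast h
    · right; exact_mod_cast h
  · have e2 : 2^(2*c+1) = 2*(2^c)^2 := by rw [← pow_mul, pow_succ, mul_comm c 2]; ring
    have hae : a % 2 = 0 := by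
      by_contra hh
      obtain ⟨d, rfl⟩ : ∃ d, a = 2*d+1 := ⟨a/2, by omega⟩
      have h3 : ∀ d, 2^(2*d+1) % 3 = 2 := by
        intro d; rw [pow_succ, pow_mul, Nat.mul_mod, Nat.pow_mod]; norm_num
      have := h3 c
      have := h3 d
      have hn3 : n^2 % 3 = 2 := by omega
      have h1 : n % 3 = 0 ∨ n % 3 = 1 ∨ n % 3 = 2 := by omega
      rcases h1 with h | h | h <;> simp [Nat.pow_mod, h] at hn3
    have hae4 : a % 4 = 0 := by
      by_contra hh
      obtain ⟨d, rfl⟩ : ∃ d, a = 4*d+2 := ⟨a/4, by omega⟩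
      have h5 : 2^(4*d+2) % 5 = 4 := by
        rw [pow_add, pow_mul, Nat.mul_mod, Nat.pow_mod]; norm_num
      have h6 : 2^(2*c+1) % 5 = 2 ∨ 2^(2*c+1) % 5 = 3 := by
        rcases Nat.even_or_odd' c with ⟨e, rfl | rfl⟩
        · left
          rw [show 2*(2*e)+1 = 4*e+1 by ring, pow_add, pow_mul, Nat.mul_mod, Nat.pow_mod]; norm_num
        · right
          rw [show 2*(2*e+1)+1 = 4*e+3 by ring, pow_add, pow_mul, Nat.mul_mod, Nat.pow_mod]; norm_num
      have hn5 : n^2 % 5 = 2 ∨ n^2 % 5 = 3 := by omega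
      have h1 : n % 5 = 0 ∨ n % 5 = 1 ∨ n % 5 = 2 ∨ n % 5 = 3 ∨ n % 5 = 4 := by omega
      rcases h1 with h | h | h | h | h <;> simp [Nat.pow_mod, h] at hn5
    by_cases h12 : 12 ≤ a
    · exact fin (odd_large n a c hn h12 hae4 hab he)
    have : a = 4 ∨ a = 8 := by omega
    rcases this with rfl | rfl
    · by_cases hc : 5 ≤ c
      · exfalso; apply pell17 n c hc; omega
      · have : c = 2 ∨ c = 3 ∨ c = 4 := by omega
        right
        have hn30 : n < 30 := by
          rcases this with rfl | rfl | rfl <;> norm_num at he <;> nlinarith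
        rcases this with rfl | rfl | rfl <;> norm_num at he <;> interval_cases n <;> omega
    · exfalso; apply pell257 n c (by omega); omega

end Szalay

theorem stmt_12 (n : ℕ) (hn : 0 < n) (hodd : Odd n) :
    s (n ^ 2) = 3 ↔ ((∃ t : ℕ, 2 ≤ t ∧ n = 2 ^ t + 1) ∨ n = 7 ∨ n = 23) := by
  constructor
  · intro h
    obtain ⟨K, hK⟩ : Odd (n^2) := hodd.pow
    rw [hK, Szalay.s_odd] at h
    obtain ⟨a, b, hab, hk⟩ := Szalay.s_two K (by omega)
    refine Szalay.core n (a+1) (b+1) hodd (by omega) (by omega) ?_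
    rw [hK, hk]; ring
  · rintro (⟨t, ht, rfl⟩ | rfl | rfl)
    · obtain ⟨u, rfl⟩ : ∃ u, t = u + 2 := ⟨t-2, by omega⟩
      have e : (2^(u+2)+1)^2 = 2*(2^(u+2)*(2*(2^u*1)+1))+1 := by ring
      rw [e, Szalay.s_odd, Szalay.s_pow_mul, Szalay.s_odd, Szalay.s_pow_mul]
      simp [s]
    · norm_num [s]
    · norm_num [s]
end

section
/- If a and b are odd positive integers with binary digit sums s(a) = ℓ ≥ 2 and s(b) = m ≥ 2 satisfying ℓm ≥ 5, and if the binary digit sum of ab equals 3, then ab < 2^(4ℓm − 13). -/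
lemma s_two_mul (n : ℕ) : s (2 * n) = s n := by
  rcases Nat.eq_zero_or_pos n with rfl | hn
  · simp
  · have := Nat.digits_add_two_add_one 0 (2 * n - 1)
    rw [show 2 * n - 1 + 1 = 2 * n by omega] at this
    unfold s
    rw [show (0 + 2) = 2 from rfl] at this
    rw [this]
    simp

lemma s_two_mul_add_one (n : ℕ) : s (2 * n + 1) = s n + 1 := by
  have := Nat.digits_add_two_add_one 0 (2 * n)
  unfold s
  rw [show (0 + 2) = 2 from rfl] at this
  rw [this]
  have h1 : (2 * n + 1) % 2 = 1 := by omega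
  have h2 : (2 * n + 1) / 2 = n := by omega
  rw [h1, h2, List.sum_cons]
  omega

lemma s_zero : s 0 = 0 := by simp [s]

lemma s_succ_le (u : ℕ) : s (u + 1) ≤ s u + 1 := by
  induction u using Nat.strong_induction_on with
  | _ u ih =>
    obtain ⟨k, hk | hk⟩ := Nat.even_or_odd' u
    · subst hk
      rw [s_two_mul_add_one, s_two_mul]
    · subst hk
      have := ih k (by omega)
      rw [show 2 * k + 1 + 1 = 2 * (k + 1) by ring, s_two_mul, s_two_mul_add_one]
      omega

lemma s_add_pow_le (v u : ℕ) : s (u + 2 ^ v) ≤ s u + 1 := by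
  induction v generalizing u with
  | zero => simpa using s_succ_le u
  | succ v ih =>
    obtain ⟨k, hk | hk⟩ := Nat.even_or_odd' u
    · subst hk
      have := ih k
      rw [show 2 * k + 2 ^ (v + 1) = 2 * (k + 2 ^ v) by ring, s_two_mul, s_two_mul]
      exact this
    · subst hk
      have := ih k
      rw [show 2 * k + 1 + 2 ^ (v + 1) = 2 * (k + 2 ^ v) + 1 by ring, s_two_mul_add_one,
        s_two_mul_add_one]
      omega

lemma s_sum_le {ι : Type*} [DecidableEq ι] (T : Finset ι) (g : ι → ℕ) :
    s (∑ i ∈ T, 2 ^ g i) ≤ T.card := by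
  induction T using Finset.induction_on with
  | empty => simp [s_zero]
  | insert a T ha ih =>
    rw [Finset.sum_insert ha, Finset.card_insert_of_notMem ha, add_comm]
    exact (s_add_pow_le _ _).trans (by omega)

lemma s_pow_sub (c d : ℕ) : s (2 ^ c * (2 ^ d - 1)) = d := by
  induction c with
  | zero =>
    simp only [pow_zero, one_mul]
    induction d with
    | zero => simp [s_zero]
    | succ d ih =>
      have : 2 ^ (d + 1) - 1 = 2 * (2 ^ d - 1) + 1 := by
        have := Nat.one_le_two_pow (n := d)
        rw [pow_succ]; omega
      rw [this, s_two_mul_add_one, ih]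
  | succ c ih => rw [pow_succ', mul_assoc, s_two_mul, ih]

/-- a group summing to a power of two has all its exponents close to the top -/
lemma window {ι : Type*} [DecidableEq ι] (T : Finset ι) (g : ι → ℕ) (x : ℕ)
    (h : ∑ i ∈ T, 2 ^ g i = 2 ^ x) (j : ι) (hj : j ∈ T) :
    x + 1 ≤ g j + T.card ∧ g j ≤ x := by
  rw [← Finset.add_sum_erase T _ hj] at h
  have h1 : 2 ^ g j ≤ 2 ^ x := by omega
  have h2 : g j ≤ x := (Nat.pow_le_pow_iff_right (by norm_num)).1 h1
  refine ⟨?_, h2⟩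
  have h3 := s_sum_le (T.erase j) g
  have h4 : ∑ i ∈ T.erase j, 2 ^ g i = 2 ^ g j * (2 ^ (x - g j) - 1) := by
    rw [Nat.mul_sub, ← pow_add, Nat.add_sub_cancel' h2]; omega
  rw [h4, s_pow_sub, Finset.card_erase_of_mem hj] at h3
  have := Finset.card_pos.2 ⟨j, hj⟩
  omega

lemma exists_group {ι : Type*} [DecidableEq ι] (x : ℕ) (g : ι → ℕ) (n : ℕ) :
    ∀ S : Finset ι, S.card = n → (∀ i ∈ S, g i ≤ x) → 2 ^ x ≤ ∑ i ∈ S, 2 ^ g i →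
    ∃ T ⊆ S, ∑ i ∈ T, 2 ^ g i = 2 ^ x := by
  induction n with
  | zero =>
    intro S hS _ h
    rw [Finset.card_eq_zero] at hS
    subst hS
    have := Nat.one_le_two_pow (n := x)
    simp at h
  | succ n ih =>
    intro S hS hg h
    obtain ⟨j, hj, hmin⟩ := Finset.exists_min_image S g (Finset.card_pos.1 (by omega))
    by_cases hc : 2 ^ x ≤ ∑ i ∈ S.erase j, 2 ^ g i
    · obtain ⟨T, hT, hs⟩ := ih (S.erase j) (by rw [Finset.card_erase_of_mem hj]; omega)
        (fun i hi => hg i (Finset.mem_of_mem_erase hi)) hc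
      exact ⟨T, hT.trans (Finset.erase_subset _ _), hs⟩
    · refine ⟨S, subset_rfl, le_antisymm ?_ h⟩
      rw [← Finset.add_sum_erase S _ hj]
      push Not at hc
      obtain ⟨u, hu⟩ : 2 ^ g j ∣ ∑ i ∈ S.erase j, 2 ^ g i :=
        Finset.dvd_sum fun i hi => pow_dvd_pow _ (hmin i (Finset.mem_of_mem_erase hi))
      obtain ⟨v, hv⟩ : 2 ^ g j ∣ 2 ^ x := pow_dvd_pow _ (hg j hj)
      rw [hu, hv] at hc
      rw [hu, hv]
      have : u < v := lt_of_mul_lt_mul_left hc (Nat.zero_le _)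
      calc 2 ^ g j + 2 ^ g j * u = 2 ^ g j * (u + 1) := by ring
        _ ≤ _ := Nat.mul_le_mul_left _ this

lemma exists_bits (n : ℕ) : ∃ A : Finset ℕ, n = ∑ e ∈ A, 2 ^ e ∧ A.card = s n := by
  induction n using Nat.strong_induction_on with
  | _ n ih =>
    rcases Nat.eq_zero_or_pos n with rfl | hn
    · exact ⟨∅, by simp, by simp [s_zero]⟩
    obtain ⟨k, hk⟩ := Nat.even_or_odd' n
    obtain ⟨A, hA, hc⟩ := ih k (by omega)
    have hs : ∑ e ∈ A.map (addRightEmbedding 1), 2 ^ e = 2 * k := by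
      rw [Finset.sum_map, hA, Finset.mul_sum]
      exact Finset.sum_congr rfl fun e _ => by simp [pow_succ']
    rcases hk with hk | hk
    · exact ⟨A.map (addRightEmbedding 1), by rw [hs, hk], by
        rw [Finset.card_map, hk, s_two_mul, hc]⟩
    · have h0 : 0 ∉ A.map (addRightEmbedding 1) := by simp
      exact ⟨insert 0 (A.map (addRightEmbedding 1)), by
        rw [Finset.sum_insert h0, hs, hk]; omega, by
        rw [Finset.card_insert_of_notMem h0, Finset.card_map, hk, s_two_mul_add_one, hc]⟩

lemma zero_mem_bits (A : Finset ℕ) (h : Odd (∑ e ∈ A, 2 ^ e)) : 0 ∈ A := by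
  by_contra h0
  rw [← Nat.not_even_iff_odd] at h
  apply h
  rw [even_iff_two_dvd]
  refine Finset.dvd_sum fun e he => dvd_pow_self 2 ?_
  rintro rfl
  exact h0 he

lemma caseA (A B : Finset ℕ) (c : ℕ → ℕ → Prop) [∀ e f, Decidable (c e f)] (x y p q : ℕ)
    (hA0 : 0 ∈ A) (hB0 : 0 ∈ B) (hAo : Odd (∑ e ∈ A, 2 ^ e)) (hA : ∃ e ∈ A, e ≠ 0)
    (hlt : (∑ e ∈ A, 2 ^ e) * (∑ f ∈ B, 2 ^ f) < 2 ^ (y + 1))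
    (h00 : ¬ c 0 0)
    (hY : ∀ e ∈ A, ∀ f ∈ B, c e f → y + 1 ≤ e + f + q)
    (hX : ∀ e ∈ A, ∀ f ∈ B, ¬ (e = 0 ∧ f = 0) → ¬ c e f → x + 1 ≤ e + f + p ∧ e + f ≤ x)
    (hsum : ∑ e ∈ A, ∑ f ∈ B, (if c e f then 2 ^ (e + f) else 0) = 2 ^ y)
    (hq : 2 * q ≤ y + 1) (hpq : p + 3 * q ≤ y + 3)
    (f₀ : ℕ) (hf₀ : f₀ ∈ B) (hc : c 0 f₀) : False := by
  have hy := hY 0 hA0 f₀ hf₀ hc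
  have hle : ∀ e ∈ A, e + f₀ ≤ y := by
    intro e he
    have h1 : 2 ^ e ≤ ∑ e ∈ A, 2 ^ e :=
      Finset.single_le_sum (f := fun e => 2 ^ e) (fun _ _ => Nat.zero_le _) he
    have h2 : 2 ^ f₀ ≤ ∑ e ∈ B, 2 ^ e :=
      Finset.single_le_sum (f := fun e => 2 ^ e) (fun _ _ => Nat.zero_le _) hf₀
    have h3 := (Nat.mul_le_mul h1 h2).trans_lt hlt
    rw [← pow_add] at h3
    have := (Nat.pow_lt_pow_iff_right (by norm_num)).1 h3
    omega
  have hX0 : ∀ e ∈ A, ¬ c e 0 := by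
    intro e he hce
    have := hY e he 0 hB0 hce
    have := hle e he
    omega
  obtain ⟨e₁, he₁, hne⟩ := hA
  have hx := hX e₁ he₁ 0 hB0 (by omega) (hX0 e₁ he₁)
  have hx' := hle e₁ he₁
  have key : ∀ e ∈ A, ∀ f ∈ B, (c e f ↔ c 0 f) := by
    intro e he f hf
    have hee := hle e he
    by_cases hf0 : f = 0
    · subst hf0
      exact ⟨fun h => absurd h (hX0 e he), fun h => absurd h h00⟩
    constructor
    · intro h
      by_contra h'
      have := hX 0 hA0 f hf (by omega) h'
      have := hY e he f hf h
      omega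
    · intro h
      by_contra h'
      have := hX e he f hf (by omega) h'
      have := hY 0 hA0 f hf h
      omega
  have hprod : (∑ e ∈ A, 2 ^ e) * (∑ f ∈ B, if c 0 f then 2 ^ f else 0) = 2 ^ y := by
    rw [← hsum, Finset.sum_mul_sum]
    refine Finset.sum_congr rfl fun e he => Finset.sum_congr rfl fun f hf => ?_
    simp only [key e he f hf, mul_ite, mul_zero, pow_add]
  have hdvd : (∑ e ∈ A, 2 ^ e) ∣ 2 ^ y := ⟨_, hprod.symm⟩
  have h1 : ∑ e ∈ A, 2 ^ e = 1 :=
    Nat.Coprime.eq_one_of_dvd (Nat.Coprime.pow_right _ hAo.coprime_two_right) hdvd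
  rw [← Finset.add_sum_erase A _ hA0] at h1
  have h2 : 2 ^ e₁ ≤ ∑ e ∈ A.erase 0, 2 ^ e :=
    Finset.single_le_sum (f := fun e => 2 ^ e) (fun _ _ => Nat.zero_le _)
      (Finset.mem_erase.2 ⟨hne, he₁⟩)
  have := Nat.one_le_two_pow (n := e₁)
  simp at h1
  rcases h1 with h1
  have h3 := h1 e₁ hne
  exact h3 he₁

lemma s_pow (k : ℕ) : s (2 ^ k) = 1 := by
  have := s_pow_sub k 1
  simpa using this

lemma s_one_add_pow (k : ℕ) : s (1 + 2 ^ k) ≤ 2 := by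
  have := s_add_pow_le k 1
  have h1 := s_pow 0
  rw [pow_zero] at h1
  omega

theorem stmt_16 (a b ℓ m : ℕ) (ha : 0 < a) (hb : 0 < b) (hao : Odd a) (hbo : Odd b)
    (hsa : s a = ℓ) (hsb : s b = m) (hℓ : 2 ≤ ℓ) (hm : 2 ≤ m) (hlm : 5 ≤ ℓ * m)
    (h : s (a * b) = 3) : a * b < 2 ^ (4 * ℓ * m - 13) := by
  classical
  obtain ⟨A, hA, hAc⟩ := exists_bits a
  obtain ⟨B, hB, hBc⟩ := exists_bits b
  obtain ⟨x, y, hxy, hab⟩ : ∃ x y, x < y ∧ a * b = 1 + (2 ^ x + 2 ^ y) := by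
    obtain ⟨C, hC, hCc⟩ := exists_bits (a * b)
    have h0 : 0 ∈ C := zero_mem_bits C (hC ▸ hao.mul hbo)
    have h2 : (C.erase 0).card = 2 := by rw [Finset.card_erase_of_mem h0]; omega
    obtain ⟨x, y, hne, hxy⟩ := Finset.card_eq_two.1 h2
    rw [← Finset.add_sum_erase C _ h0, hxy, Finset.sum_pair hne] at hC
    rcases lt_or_gt_of_ne hne with hl | hl
    · exact ⟨x, y, hl, by simpa using hC⟩
    · exact ⟨y, x, hl, by rw [add_comm (2 ^ y)]; simpa using hC⟩
  have hA0 : 0 ∈ A := zero_mem_bits A (hA ▸ hao)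
  have hB0 : 0 ∈ B := zero_mem_bits B (hB ▸ hbo)
  have hx1 : 1 ≤ 2 ^ x := Nat.one_le_two_pow
  have hxy2 : 2 * 2 ^ x ≤ 2 ^ y := by
    rw [← pow_succ']; exact Nat.pow_le_pow_right (by norm_num) hxy
  have hablt : a * b < 2 ^ (y + 1) ∨ x = 0 := by
    rcases Nat.eq_zero_or_pos x with hx | hx
    · right; exact hx
    · left
      have : 2 ^ 1 ≤ 2 ^ x := Nat.pow_le_pow_right (by norm_num) hx
      rw [hab, pow_succ]; omega
  have hablt : a * b < 2 ^ (y + 1) := by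
    rcases hablt with h1 | h1
    · exact h1
    · exfalso
      subst h1
      have h2 := hao.mul hbo
      rw [hab] at h2
      have hs := s_add_pow_le y 2
      have h3 := s_pow 1
      rw [pow_one] at h3
      rw [hab, pow_zero, ← add_assoc] at h
      norm_num at h
      omega
  by_contra hcon
  push Not at hcon
  have hyN : 4 * ℓ * m - 13 < y + 1 :=
    (Nat.pow_lt_pow_iff_right (by norm_num : 1 < 2)).1 (hcon.trans_lt hablt)
  have hN4 : 4 * ℓ * m = 4 * (ℓ * m) := by ring
  set N := ℓ * m with hN
  set S := (A ×ˢ B).erase (0, 0) with hS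
  have h00 : ((0, 0) : ℕ × ℕ) ∈ A ×ˢ B := Finset.mk_mem_product hA0 hB0
  have hScard : S.card + 1 = N := by
    rw [hS, Finset.card_erase_of_mem h00, Finset.card_product, hAc, hBc, hsa, hsb]; omega
  have hSsum : ∑ i ∈ S, 2 ^ (i.1 + i.2) = 2 ^ x + 2 ^ y := by
    have h1 : ∑ i ∈ A ×ˢ B, 2 ^ (i.1 + i.2) = a * b := by
      rw [hA, hB, Finset.sum_mul_sum, Finset.sum_product]
      simp only [pow_add]
    rw [← Finset.add_sum_erase _ _ h00, hab] at h1
    simp only [add_zero, pow_zero] at h1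
    rw [← hS] at h1
    omega
  have hSle : ∀ i ∈ S, i.1 + i.2 ≤ y := by
    intro i hi
    have h1 : 2 ^ (i.1 + i.2) ≤ ∑ i ∈ S, 2 ^ (i.1 + i.2) :=
      Finset.single_le_sum (f := fun i : ℕ × ℕ => 2 ^ (i.1 + i.2))
        (fun _ _ => Nat.zero_le _) hi
    have h2 : 2 ^ (i.1 + i.2) < 2 ^ (y + 1) := by rw [pow_succ]; omega
    have := (Nat.pow_lt_pow_iff_right (by norm_num)).1 h2
    omega
  obtain ⟨T, hTS, hT⟩ := exists_group y (fun i : ℕ × ℕ => i.1 + i.2) S.card S rfl hSle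
    (by rw [hSsum]; omega)
  have hXs : ∑ i ∈ S \ T, 2 ^ (i.1 + i.2) = 2 ^ x := by
    have := Finset.sum_sdiff hTS (f := fun i : ℕ × ℕ => 2 ^ (i.1 + i.2))
    omega
  have hcard := Finset.card_sdiff_add_card_eq_card hTS
  have wY := window T _ y hT
  have wX := window (S \ T) _ x hXs
  set p := (S \ T).card with hp
  set q := T.card with hq
  have hppos : 1 ≤ p := by
    rw [hp, Nat.one_le_iff_ne_zero, Finset.card_ne_zero, Finset.nonempty_iff_ne_empty]
    intro h0
    rw [h0] at hXs
    simp at hXs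
    omega
  have hqpos : 1 ≤ q := by
    rw [hq, Nat.one_le_iff_ne_zero, Finset.card_ne_zero, Finset.nonempty_iff_ne_empty]
    intro h0
    rw [h0] at hT
    simp at hT
    omega
  have hT00 : ((0, 0) : ℕ × ℕ) ∉ T := fun h0 => by
    have := hTS h0
    simp [hS] at this
  have hY : ∀ e ∈ A, ∀ f ∈ B, (e, f) ∈ T → y + 1 ≤ e + f + q := fun e _ f _ hh => (wY _ hh).1
  have memX : ∀ e ∈ A, ∀ f ∈ B, ¬ (e = 0 ∧ f = 0) → (e, f) ∉ T → (e, f) ∈ S \ T := by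
    intro e he f hf hne hh
    refine Finset.mem_sdiff.2 ⟨Finset.mem_erase.2 ⟨?_, Finset.mk_mem_product he hf⟩, hh⟩
    simpa [Prod.ext_iff] using hne
  have hX : ∀ e ∈ A, ∀ f ∈ B, ¬ (e = 0 ∧ f = 0) → (e, f) ∉ T →
      x + 1 ≤ e + f + p ∧ e + f ≤ x := fun e he f hf hne hh => wX _ (memX e he f hf hne hh)
  have hsum : ∑ e ∈ A, ∑ f ∈ B, (if (e, f) ∈ T then 2 ^ (e + f) else 0) = 2 ^ y := by
    rw [← hT, ← Finset.sum_product' A B (fun e f => if (e, f) ∈ T then 2 ^ (e + f) else 0),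
      ← Finset.sum_filter]
    refine Finset.sum_congr ?_ fun _ _ => rfl
    ext i
    simp only [Finset.mem_filter]
    exact ⟨fun h => h.2, fun h => ⟨Finset.mem_of_mem_erase (hTS h), h⟩⟩
  have hAne : ∃ e ∈ A, e ≠ 0 := by
    obtain ⟨e, he, h0⟩ := Finset.exists_mem_ne (by omega : 1 < A.card) 0
    exact ⟨e, he, h0⟩
  have hBne : ∃ e ∈ B, e ≠ 0 := by
    obtain ⟨e, he, h0⟩ := Finset.exists_mem_ne (by omega : 1 < B.card) 0
    exact ⟨e, he, h0⟩
  have hBX : ∀ f ∈ B, (0, f) ∉ T := fun f hf hc =>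
    caseA A B (fun e f => (e, f) ∈ T) x y p q hA0 hB0 (hA ▸ hao) hAne
      (by rw [← hA, ← hB]; exact hablt) hT00 hY hX hsum (by omega) (by omega) f hf hc
  have hAX : ∀ e ∈ A, (e, 0) ∉ T := fun e he hc =>
    caseA B A (fun f e => (e, f) ∈ T) x y p q hB0 hA0 (hB ▸ hbo) hBne
      (by rw [← hA, ← hB, mul_comm]; exact hablt) hT00
      (fun f hf e he hh => by rw [add_comm f e]; exact hY e he f hf hh)
      (fun f hf e he hne hh => by
        rw [add_comm f e]; exact hX e he f hf (fun h => hne h.symm) hh)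
      (by rw [Finset.sum_comm, ← hsum]; simp only [add_comm]) (by omega) (by omega) e he hc
  -- a - 1 + b - 1 ≤ 2 ^ x
  have ha1 : a = 1 + ∑ e ∈ A.erase 0, 2 ^ e := by
    conv_lhs => rw [hA, ← Finset.add_sum_erase A _ hA0]
    simp
  have hb1 : b = 1 + ∑ e ∈ B.erase 0, 2 ^ e := by
    conv_lhs => rw [hB, ← Finset.add_sum_erase B _ hB0]
    simp
  set a' := ∑ e ∈ A.erase 0, 2 ^ e with ha'
  set b' := ∑ e ∈ B.erase 0, 2 ^ e with hb'
  set U := (A.erase 0).image (fun e => ((e, 0) : ℕ × ℕ)) ∪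
    (B.erase 0).image (fun f => ((0, f) : ℕ × ℕ)) with hU
  have hUs : ∑ i ∈ U, 2 ^ (i.1 + i.2) = a' + b' := by
    rw [hU, Finset.sum_union, Finset.sum_image (by intro _ _ _ _ h; simpa using h),
      Finset.sum_image (by intro _ _ _ _ h; simpa using h)]
    · simp [ha', hb']
    · rw [Finset.disjoint_left]
      rintro ⟨e, f⟩ h1 h2
      simp at h1 h2
      omega
  have hUX : U ⊆ S \ T := by
    rintro ⟨e, f⟩ h1
    simp only [hU, Finset.mem_union, Finset.mem_image, Finset.mem_erase,
      Prod.mk.injEq] at h1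
    rcases h1 with ⟨e', ⟨h1, h2⟩, rfl, rfl⟩ | ⟨e', ⟨h1, h2⟩, rfl, rfl⟩
    · exact memX _ h2 _ hB0 (by omega) (hAX _ h2)
    · exact memX _ hA0 _ h2 (by omega) (hBX _ h2)
  have hle : a' + b' ≤ 2 ^ x := by
    rw [← hUs, ← hXs]
    exact Finset.sum_le_sum_of_subset hUX
  have two_le : ∀ D : Finset ℕ, (∃ e ∈ D, e ≠ 0) → 2 ≤ ∑ e ∈ D.erase 0, 2 ^ e := by
    rintro D ⟨e, he, h0⟩
    have h2 : 2 ^ e ≤ ∑ e ∈ D.erase 0, 2 ^ e :=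
      Finset.single_le_sum (f := fun e => 2 ^ e) (fun _ _ => Nat.zero_le _)
        (Finset.mem_erase.2 ⟨h0, he⟩)
    have : 2 ^ 1 ≤ 2 ^ e := Nat.pow_le_pow_right (by norm_num) (by omega)
    omega
  have ha2 := two_le A hAne
  have hb2 := two_le B hBne
  rw [← ha'] at ha2
  rw [← hb'] at hb2
  by_cases hall : ∀ e ∈ A, ∀ f ∈ B, e ≠ 0 → f ≠ 0 → (e, f) ∈ T
  · -- product is a power of two
    have hprod : a' * b' ≤ 2 ^ y := by
      rw [ha', hb', Finset.sum_mul_sum, ← hT, ← Finset.sum_product']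
      simp only [← pow_add]
      refine Finset.sum_le_sum_of_subset ?_
      rintro ⟨e, f⟩ h1
      simp only [Finset.mem_product, Finset.mem_erase] at h1
      exact hall e h1.1.2 f h1.2.2 h1.1.1 h1.2.1
    have hprod : a' * b' = 2 ^ y := by
      have : a * b = 1 + (a' + b' + a' * b') := by rw [ha1, hb1]; ring
      omega
    obtain ⟨i, _, hi⟩ := (Nat.dvd_prime_pow Nat.prime_two).1 (Dvd.intro _ hprod)
    obtain ⟨j, _, hj⟩ := (Nat.dvd_prime_pow Nat.prime_two).1 (Dvd.intro_left _ hprod)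
    have h1 := s_one_add_pow i
    have h2 := s_one_add_pow j
    rw [← hi, ← ha1, hsa] at h1
    rw [← hj, ← hb1, hsb] at h2
    have : N ≤ 2 * 2 := Nat.mul_le_mul h1 h2
    omega
  · push Not at hall
    obtain ⟨e, he, f, hf, he0, hf0, hef⟩ := hall
    have h1 := hX e he f hf (by omega) hef
    have h2 := hX e he 0 hB0 (by omega) (hAX e he)
    have h3 := hX 0 hA0 f hf (by omega) (hBX f hf)
    have hx2 : x + 2 ≤ 2 * p := by omega
    have hy2 : y < 2 * x := by
      have h4 : a * b < 2 ^ x * 2 ^ x :=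
        Nat.mul_lt_mul'' (by omega) (by omega)
      rw [← pow_add] at h4
      have h5 : 2 ^ y < 2 ^ (x + x) := by omega
      have := (Nat.pow_lt_pow_iff_right (by norm_num)).1 h5
      omega
    by_cases hq1 : q = 1
    · obtain ⟨⟨u, v⟩, huv⟩ := Finset.card_eq_one.1 hq1
      rw [huv, Finset.sum_singleton] at hT
      have hy := Nat.pow_right_injective (le_refl 2) hT
      simp only at hy
      have hmem : (u, v) ∈ T := by rw [huv]; simp
      have hAB := Finset.mem_product.1 (Finset.mem_of_mem_erase (hTS hmem))
      have hu0 : u ≠ 0 := by rintro rfl; exact hBX _ hAB.2 hmem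
      have hv0 : v ≠ 0 := by rintro rfl; exact hAX _ hAB.1 hmem
      have hu : 2 ^ u ≤ a' :=
        Finset.single_le_sum (f := fun e => 2 ^ e) (fun _ _ => Nat.zero_le _)
          (Finset.mem_erase.2 ⟨hu0, hAB.1⟩)
      have hv : 2 ^ v ≤ b' :=
        Finset.single_le_sum (f := fun e => 2 ^ e) (fun _ _ => Nat.zero_le _)
          (Finset.mem_erase.2 ⟨hv0, hAB.2⟩)
      have hu : u < x := (Nat.pow_lt_pow_iff_right (by norm_num : 1 < 2)).1 (by omega)
      have hv : v < x := (Nat.pow_lt_pow_iff_right (by norm_num : 1 < 2)).1 (by omega)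
      omega
    · omega
end
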